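/- arXiv:1609.05829 — 4 statements merged into one kernel-verified Lean document; each statement's English description precedes it below -/
import Mathlib

section
/- Let D be the ℚ-linear derivation on the polynomial ring ℚ[x,y,z,q] determined by D(x) = q·x·y, D(y) = y·z, D(z) = y·z and D(q) = 0. Then for every n ≥ 1, D^n(x) = x · Σ_{π ∈ S_n} y^{aexc(π)} z^{exc(π)} q^{cyc(π)}, where the sum is over all permutations π of [n]. -/
open MvPolynomial Finset

/-- `exc π` is the number of excedances of `π`: indices `i` with `π(i) > i`. -/
def exc {n : ℕ} (π : Equiv.Perm (Fin n)) : ℕ :=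
  (Finset.univ.filter fun i => i < π i).card

/-- `aexc π` is the number of anti-excedances of `π`: indices `i` with `π(i) ≤ i`. -/
def aexc {n : ℕ} (π : Equiv.Perm (Fin n)) : ℕ :=
  (Finset.univ.filter fun i => π i ≤ i).card

/-- `cyc π` is the number of cycles (orbits) of `π`, fixed points counting as cycles:
the number of nontrivial cycles plus the number of fixed points. -/
def cyc {n : ℕ} (π : Equiv.Perm (Fin n)) : ℕ :=
  π.cycleType.card + (Finset.univ.filter fun i => π i = i).card

namespace Equiv.Perm

variable {α : Type*} [DecidableEq α] [Fintype α]

/-- Composing a permutation `σ` with a transposition of a fixed point `a` of `σ` and another point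
inserts `a` into the orbit of that point. -/
theorem SameCycle.swap_mul {σ : Perm α} {a b y : α} (ha : σ a = a)
    (h : σ.SameCycle b y) : (swap a b * σ).SameCycle b y := by
  obtain ⟨n, rfl⟩ := h.exists_nat_pow_eq
  clear h
  induction n with
  | zero => exact SameCycle.refl _ _
  | succ n ih =>
    rw [pow_succ', mul_apply]
    generalize (σ ^ n) b = y at ih
    by_cases hya : y = a
    · rwa [show σ y = y by rw [hya, ha]]
    by_cases hyb : σ y = b
    · rw [hyb]
    · have h1 : (swap a b * σ) y = σ y := by
        rw [mul_apply, swap_apply_of_ne_of_ne _ hyb]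
        rw [← ha]
        exact fun h => hya (σ.injective h)
      rw [← h1]
      exact sameCycle_apply_right.2 ih

theorem support_swap_mul_of_apply_eq {σ : Perm α} {a b : α} (ha : σ a = a) (hb : σ b ≠ b) :
    (swap a b * σ).support = insert a σ.support := by
  have hab : a ≠ b := fun h => hb (h ▸ ha)
  ext y
  simp only [mem_support, mem_insert, mul_apply]
  by_cases hya : y = a
  · simp [hya, ha, hab.symm]
  · have h1 : σ y ≠ a := by
      rw [← ha]
      exact fun h => hya (σ.injective h)
    by_cases hyb : σ y = b
    · have : b ≠ y := fun h => hb (by rw [← h] at hyb; exact hyb)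
      simp [hyb, hya, Ne.symm hya, this]
    · simp [swap_apply_of_ne_of_ne h1 hyb, hya]

theorem IsCycle.swap_mul_of_apply_eq {σ : Perm α} (hσ : σ.IsCycle) {a b : α} (ha : σ a = a)
    (hb : σ b ≠ b) : (swap a b * σ).IsCycle := by
  refine ⟨b, ?_, fun y hy => ?_⟩
  · rw [← mem_support, support_swap_mul_of_apply_eq ha hb]
    exact mem_insert_of_mem (mem_support.2 hb)
  · rw [← mem_support, support_swap_mul_of_apply_eq ha hb, mem_insert] at hy
    rcases hy with rfl | hy
    · have h1 : (swap y b * σ) y = b := by simp [ha]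
      rw [← sameCycle_apply_right, h1]
    · exact (hσ.sameCycle hb (mem_support.1 hy)).swap_mul ha

theorem card_cycleType_swap_mul {σ : Perm α} {a b : α} (ha : σ a = a) (hab : a ≠ b) :
    (swap a b * σ).cycleType.card + (σ.support.card + 1) =
      σ.cycleType.card + (swap a b * σ).support.card := by
  by_cases hb : σ b = b
  · have hd : Disjoint (swap a b) σ := by
      rw [disjoint_iff_disjoint_support, support_swap hab]
      simp [ha, hb]
    rw [hd.cycleType_mul, hd.card_support_mul, card_support_swap hab,
      (isCycle_swap hab).cycleType]
    simp
    ring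
  · set c := σ.cycleOf b with hc
    have hcyc : c.IsCycle := isCycle_cycleOf σ hb
    have hmem : c ∈ σ.cycleFactorsFinset :=
      cycleOf_mem_cycleFactorsFinset_iff.2 (mem_support.2 hb)
    have hd : Disjoint (σ * c⁻¹) c := disjoint_mul_inv_of_mem_cycleFactorsFinset hmem
    have hcb : c b ≠ b := by rwa [hc, cycleOf_apply_self]
    have hca : c a = a := by
      by_contra h
      exact mem_support.1 (mem_cycleFactorsFinset_support_le hmem (mem_support.2 h)) ha
    set r := σ * c⁻¹ with hr
    have hra : r a = a := by
      rw [hr, mul_apply, inv_eq_iff_eq.2 hca.symm, ha]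
    have hd' : Disjoint (swap a b * c) r := by
      rw [disjoint_iff_disjoint_support, support_swap_mul_of_apply_eq hca hcb,
        Finset.disjoint_insert_left]
      exact ⟨by simpa using hra, disjoint_iff_disjoint_support.1 hd.symm⟩
    have hσ : σ = c * r := by rw [← hd.commute.eq, hr, inv_mul_cancel_right]
    have hcyc' := hcyc.swap_mul_of_apply_eq hca hcb
    rw [hσ, ← mul_assoc, hd'.cycleType_mul, hd'.card_support_mul, hd.symm.cycleType_mul,
      hd.symm.card_support_mul, hcyc.cycleType, hcyc'.cycleType,
      support_swap_mul_of_apply_eq hca hcb, card_insert_of_notMem (by simpa using hca)]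
    simp
    ring

theorem decomposeFin_symm_eq_swap_mul {n : ℕ} (p : Fin (n + 1)) (e : Perm (Fin n)) :
    decomposeFin.symm (p, e) = swap 0 p * e.extendDomain (finSuccAboveEquiv 0) := by
  ext i
  congr 1
  induction i using Fin.cases with
  | zero =>
    rw [decomposeFin_symm_apply_zero, mul_apply, extendDomain_apply_not_subtype _ _ (by simp),
      swap_apply_left]
  | succ i =>
    have h := extendDomain_apply_image e (finSuccAboveEquiv (0 : Fin (n + 1))) i
    simp only [finSuccAboveEquiv_apply, Fin.zero_succAbove] at h
    rw [decomposeFin_symm_apply_succ, mul_apply, h]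

end Equiv.Perm

open Equiv.Perm

theorem cyc_add_card_support {n : ℕ} (π : Equiv.Perm (Fin n)) :
    cyc π + π.support.card = π.cycleType.card + n := by
  have h := Finset.card_filter_add_card_filter_not (s := (Finset.univ : Finset (Fin n)))
    (fun i => π i = i)
  rw [Finset.card_univ, Fintype.card_fin] at h
  have h2 : π.support = Finset.univ.filter fun i => ¬ π i = i := by
    ext; simp
  rw [cyc, h2]
  omega

theorem cyc_decomposeFin_symm_zero {n : ℕ} (e : Equiv.Perm (Fin n)) :
    cyc (decomposeFin.symm (0, e)) = cyc e + 1 := by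
  have h1 := cyc_add_card_support (decomposeFin.symm (0, e))
  have h2 := cyc_add_card_support e
  rw [decomposeFin_symm_eq_swap_mul, Equiv.swap_self, ← Equiv.Perm.one_def, one_mul,
    card_support_extend_domain, cycleType_extendDomain] at h1
  rw [decomposeFin_symm_eq_swap_mul, Equiv.swap_self, ← Equiv.Perm.one_def, one_mul]
  omega

theorem cyc_decomposeFin_symm_succ {n : ℕ} (q : Fin n) (e : Equiv.Perm (Fin n)) :
    cyc (decomposeFin.symm (q.succ, e)) = cyc e := by
  have h1 := cyc_add_card_support (decomposeFin.symm (q.succ, e))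
  have h2 := cyc_add_card_support e
  have h3 := card_cycleType_swap_mul (b := q.succ)
    (extendDomain_apply_not_subtype e (finSuccAboveEquiv (0 : Fin (n + 1))) (b := 0) (by simp))
    (Fin.succ_ne_zero q).symm
  rw [← decomposeFin_symm_eq_swap_mul, card_support_extend_domain, cycleType_extendDomain] at h3
  omega

theorem exc_decomposeFin_symm_zero {n : ℕ} (e : Equiv.Perm (Fin n)) :
    exc (decomposeFin.symm (0, e)) = exc e := by
  simp [exc, Fin.card_filter_univ_succ]

theorem aexc_decomposeFin_symm_zero {n : ℕ} (e : Equiv.Perm (Fin n)) :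
    aexc (decomposeFin.symm (0, e)) = aexc e + 1 := by
  simp [aexc, Fin.card_filter_univ_succ]

theorem decomposeFin_symm_apply_succ_eq_ite {n : ℕ} (e : Equiv.Perm (Fin n)) (i j : Fin n) :
    decomposeFin.symm ((e j).succ, e) i.succ = if i = j then 0 else (e i).succ := by
  rw [decomposeFin_symm_apply_succ]
  split_ifs with h
  · rw [h, Equiv.swap_apply_right]
  · exact Equiv.swap_apply_of_ne_of_ne (Fin.succ_ne_zero _)
      fun h' => h (e.injective (Fin.succ_injective _ h'))

theorem exc_decomposeFin_symm_succ {n : ℕ} (e : Equiv.Perm (Fin n)) (j : Fin n) :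
    exc (decomposeFin.symm ((e j).succ, e)) = if j < e j then exc e else exc e + 1 := by
  have h : (Finset.univ.filter fun i : Fin n =>
      i.succ < decomposeFin.symm ((e j).succ, e) i.succ) =
      (Finset.univ.filter fun i => i < e i).erase j := by
    ext i
    simp only [decomposeFin_symm_apply_succ_eq_ite]
    by_cases hij : i = j <;> simp [hij]
  rw [exc, Fin.card_filter_univ_succ]
  simp only [decomposeFin_symm_apply_zero, Fin.succ_pos, if_true] at h ⊢
  rw [h]
  split_ifs with hj
  · rw [Finset.card_erase_add_one (by simpa using hj), exc]
  · rw [Finset.erase_eq_of_notMem (by simpa using hj), exc]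

theorem aexc_decomposeFin_symm_succ {n : ℕ} (e : Equiv.Perm (Fin n)) (j : Fin n) :
    aexc (decomposeFin.symm ((e j).succ, e)) = if j < e j then aexc e + 1 else aexc e := by
  have h : (Finset.univ.filter fun i : Fin n =>
      decomposeFin.symm ((e j).succ, e) i.succ ≤ i.succ) =
      insert j (Finset.univ.filter fun i => e i ≤ i) := by
    ext i
    simp only [decomposeFin_symm_apply_succ_eq_ite]
    by_cases hij : i = j <;> simp [hij]
  rw [aexc, Fin.card_filter_univ_succ]
  simp only [decomposeFin_symm_apply_zero, Fin.le_zero_iff, Fin.succ_ne_zero,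
    if_false] at h ⊢
  rw [h]
  split_ifs with hj
  · rw [Finset.card_insert_of_notMem (by simpa using hj), aexc]
  · rw [Finset.insert_eq_of_mem (by simpa using hj), aexc]

/-- Summing the weights over all permutations obtained from `e` by inserting a new smallest
element. -/
theorem sum_weight_decomposeFin_symm {R : Type*} [CommRing R] (y z q : R) {n : ℕ}
    (e : Equiv.Perm (Fin n)) :
    ∑ p : Fin (n + 1), y ^ aexc (decomposeFin.symm (p, e)) *
      z ^ exc (decomposeFin.symm (p, e)) * q ^ cyc (decomposeFin.symm (p, e)) =
    (q * y + aexc e * z + exc e * y) * (y ^ aexc e * z ^ exc e * q ^ cyc e) := by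
  rw [Fin.sum_univ_succ, ← Equiv.sum_comp e]
  have h : ∀ j, y ^ aexc (decomposeFin.symm ((e j).succ, e)) *
      z ^ exc (decomposeFin.symm ((e j).succ, e)) * q ^ cyc (decomposeFin.symm ((e j).succ, e)) =
      ((if j < e j then y else 0) + (if e j ≤ j then z else 0)) *
        (y ^ aexc e * z ^ exc e * q ^ cyc e) := by
    intro j
    rw [aexc_decomposeFin_symm_succ, exc_decomposeFin_symm_succ, cyc_decomposeFin_symm_succ]
    by_cases hj : j < e j
    · simp only [hj, not_le.2 hj, if_true, if_false]
      ring
    · simp only [hj, not_lt.1 hj, if_true, if_false]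
      ring
  simp only [h]
  rw [← Finset.sum_mul, Finset.sum_add_distrib, ← Finset.sum_filter, ← Finset.sum_filter,
    Finset.sum_const, Finset.sum_const, aexc_decomposeFin_symm_zero, exc_decomposeFin_symm_zero,
    cyc_decomposeFin_symm_zero, nsmul_eq_mul, nsmul_eq_mul]
  change _ + ((exc e : R) * y + (aexc e : R) * z) * _ = _
  ring

theorem Derivation.apply_pow_of_apply_eq_mul {R A : Type*} [CommRing R] [CommRing A]
    [Algebra R A] (D : Derivation R A A) {a b : A} (h : D a = a * b) (n : ℕ) :
    D (a ^ n) = n * b * a ^ n := by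
  rw [D.leibniz_pow, h]
  cases n with
  | zero => simp
  | succ n =>
    simp only [Nat.add_sub_cancel, nsmul_eq_mul, smul_eq_mul]
    ring

theorem stmt2
    (D : Derivation ℚ (MvPolynomial (Fin 4) ℚ) (MvPolynomial (Fin 4) ℚ))
    (hx : D (X 0) = X 3 * X 0 * X 1) (hy : D (X 1) = X 1 * X 2)
    (hz : D (X 2) = X 1 * X 2) (hq : D (X 3) = 0) :
    ∀ n : ℕ, 1 ≤ n →
      (⇑D)^[n] (X 0) =
        X 0 * ∑ π : Equiv.Perm (Fin n),
          X 1 ^ aexc π * X 2 ^ exc π * X 3 ^ cyc π := by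
  intro n _
  clear * - hx hy hz hq
  induction n with
  | zero => simp [aexc, exc, cyc]
  | succ n ih =>
    rw [Function.iterate_succ_apply', ih, D.leibniz, map_sum, hx,
      ← Equiv.sum_comp decomposeFin.symm, Fintype.sum_prod_type_right]
    simp only [sum_weight_decomposeFin_symm, smul_eq_mul]
    rw [Finset.mul_sum, Finset.sum_mul, ← Finset.sum_add_distrib, Finset.mul_sum]
    refine Finset.sum_congr rfl fun e _ => ?_
    rw [D.leibniz, D.leibniz, D.apply_pow_of_apply_eq_mul hy,
      D.apply_pow_of_apply_eq_mul (hz.trans (mul_comm _ _)), D.leibniz_pow, hq]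
    simp only [smul_eq_mul, smul_zero, mul_zero]
    ring
end

section
/- Let D be the ℚ-linear derivation on the polynomial ring ℚ[x,y,z,u,q] determined by D(x) = q·x·y·u, D(y) = x·y·z, D(z) = y·z·u, D(u) = q·x·z·u and D(q) = 0. Then for every n ≥ 1, D^n(x·y) = x·y · Σ_{π ∈ B_n} (x·z)^{asc_B(π)} (y·u)^{des_B(π)} q^{N(π)}, where the sum is over all signed permutations π of [n]. -/
open MvPolynomial Finset

/-- A signed permutation of `[n]`, given as a pair of a permutation `σ` of `[n]`
and a sign vector `ε`, sends `i ∈ [n]` (represented by `Fin n`) to the signed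
value `ε(i)·σ(i) ∈ ±[n]`. -/
def signedVal {n : ℕ} (p : Equiv.Perm (Fin n) × (Fin n → Bool)) (i : Fin n) : ℤ :=
  (if p.2 i then 1 else -1) * ((p.1 i : ℕ) + 1)

/-- The word `π(0)π(1)⋯π(n)` of a signed permutation, with `π(0) = 0`:
`bval p j = π(j)` for `0 ≤ j ≤ n`. -/
def bval {n : ℕ} (p : Equiv.Perm (Fin n) × (Fin n → Bool)) (j : ℕ) : ℤ :=
  if h : 1 ≤ j ∧ j ≤ n then signedVal p ⟨j - 1, by omega⟩ else 0

/-- `desB π = #{i ∈ {0,…,n−1} : π(i) > π(i+1)}`. -/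
def desB {n : ℕ} (p : Equiv.Perm (Fin n) × (Fin n → Bool)) : ℕ :=
  ((Finset.range n).filter fun i => bval p (i + 1) < bval p i).card

/-- `ascB π = #{i ∈ {0,…,n−1} : π(i) < π(i+1)}`. -/
def ascB {n : ℕ} (p : Equiv.Perm (Fin n) × (Fin n → Bool)) : ℕ :=
  ((Finset.range n).filter fun i => bval p i < bval p (i + 1)).card

/-- `N(π) = #{i ∈ [n] : π(i) < 0}`. -/
def negCount {n : ℕ} (p : Equiv.Perm (Fin n) × (Fin n → Bool)) : ℕ :=
  (Finset.univ.filter fun i : Fin n => signedVal p i < 0).card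

/-- Insert the letter `±(n+1)` (sign `s`, `true` meaning `+`) at position `k` of a signed
permutation of `[n]`. -/
def insertMax {n : ℕ} (k : Fin (n + 1)) (s : Bool) (p : Equiv.Perm (Fin n) × (Fin n → Bool)) :
    Equiv.Perm (Fin (n + 1)) × (Fin (n + 1) → Bool) :=
  (((finSuccEquiv' k).trans p.1.optionCongr).trans (finSuccEquiv' (Fin.last n)).symm,
    k.insertNth s p.2)

section insertMax

variable {n : ℕ} (k : Fin (n + 1)) (s : Bool) (p : Equiv.Perm (Fin n) × (Fin n → Bool))

theorem insertMax_fst_self : (insertMax k s p).1 k = Fin.last n := by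
  simp [insertMax]

theorem insertMax_fst_succAbove (i : Fin n) :
    (insertMax k s p).1 (k.succAbove i) = (p.1 i).castSucc := by
  simp [insertMax]

theorem signedVal_insertMax_self :
    signedVal (insertMax k s p) k = (if s then 1 else -1) * ((n : ℤ) + 1) := by
  simp [signedVal, insertMax]

theorem signedVal_insertMax_succAbove (i : Fin n) :
    signedVal (insertMax k s p) (k.succAbove i) = signedVal p i := by
  simp only [signedVal, insertMax_fst_succAbove]
  simp [insertMax]

theorem insertMax_injective :
    Function.Injective fun t : (Fin (n + 1) × Bool) × (Equiv.Perm (Fin n) × (Fin n → Bool)) =>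
      insertMax t.1.1 t.1.2 t.2 := by
  rintro ⟨⟨k, s⟩, p⟩ ⟨⟨l, t⟩, r⟩ h
  dsimp only at h
  obtain rfl : k = l := by
    apply (insertMax k s p).1.injective
    rw [insertMax_fst_self, h, insertMax_fst_self]
  have h2 : k.insertNth (α := fun _ => Bool) s p.2 = k.insertNth t r.2 := congrArg Prod.snd h
  have hs : s = t := by simpa using congrFun h2 k
  have hp2 : p.2 = r.2 := by
    ext1 i
    simpa using congrFun h2 (k.succAbove i)
  have hp1 : p.1 = r.1 := by
    ext1 i
    have := congrArg (fun x => x.1 (k.succAbove i)) h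
    simpa [insertMax_fst_succAbove] using this
  rw [hs, Prod.ext hp1 hp2]

theorem insertMax_bijective :
    Function.Bijective fun t : (Fin (n + 1) × Bool) × (Equiv.Perm (Fin n) × (Fin n → Bool)) =>
      insertMax t.1.1 t.1.2 t.2 := by
  rw [Fintype.bijective_iff_injective_and_card]
  refine ⟨insertMax_injective, ?_⟩
  simp only [Fintype.card_prod, Fintype.card_perm, Fintype.card_fin, Fintype.card_bool,
    Fintype.card_pi, Finset.prod_const, Finset.card_univ, Nat.factorial_succ]
  ring

theorem bval_insertMax_of_le {j : ℕ} (hj : j ≤ k) : bval (insertMax k s p) j = bval p j := by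
  have hk := k.is_lt
  unfold bval
  by_cases h : 1 ≤ j
  · rw [dif_pos ⟨h, by omega⟩, dif_pos ⟨h, by omega⟩, ← signedVal_insertMax_succAbove k s p]
    congr 1
    rw [Fin.succAbove_of_castSucc_lt _ _ (by simp [Fin.lt_def]; omega)]
    rfl
  · rw [dif_neg (by omega), dif_neg (by omega)]

theorem bval_insertMax_self :
    bval (insertMax k s p) (k + 1) = (if s then 1 else -1) * ((n : ℤ) + 1) := by
  have hk := k.is_lt
  unfold bval
  rw [dif_pos ⟨by omega, by omega⟩, ← signedVal_insertMax_self k s p]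
  rfl

theorem bval_insertMax_of_lt {j : ℕ} (hj : (k : ℕ) < j) (hn : j ≤ n) :
    bval (insertMax k s p) (j + 1) = bval p j := by
  unfold bval
  rw [dif_pos ⟨by omega, by omega⟩, dif_pos ⟨by omega, hn⟩,
    ← signedVal_insertMax_succAbove k s p]
  congr 1
  rw [Fin.succAbove_of_le_castSucc _ _ (by simp [Fin.le_def]; omega)]
  ext
  simp
  omega

end insertMax

section words

variable {n : ℕ} (p : Equiv.Perm (Fin n) × (Fin n → Bool))

theorem natAbs_signedVal (i : Fin n) : (signedVal p i).natAbs = (p.1 i : ℕ) + 1 := by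
  unfold signedVal
  split_ifs <;> omega

theorem abs_bval_le (j : ℕ) : |bval p j| ≤ n := by
  unfold bval
  split_ifs with h
  · have := natAbs_signedVal p ⟨j - 1, by omega⟩
    have := (p.1 ⟨j - 1, by omega⟩).is_lt
    rw [Int.abs_eq_natAbs]
    omega
  · simp

theorem bval_ne_bval_succ {i : ℕ} (hi : i < n) : bval p i ≠ bval p (i + 1) := by
  intro h
  unfold bval at h
  rw [dif_pos (⟨by omega, by omega⟩ : 1 ≤ i + 1 ∧ i + 1 ≤ n)] at h
  have h1 := natAbs_signedVal p ⟨i + 1 - 1, by omega⟩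
  split_ifs at h with h0
  · have h2 := natAbs_signedVal p ⟨i - 1, by omega⟩
    rw [h] at h2
    have := p.1.injective (Fin.ext (by omega :
      (p.1 ⟨i + 1 - 1, _⟩ : ℕ) = p.1 ⟨i - 1, _⟩))
    simp only [Fin.mk.injEq] at this
    omega
  · rw [← h] at h1
    simp at h1

end words

section weight

variable {R : Type*} [CommRing R]

/-- The weight of a step of a word: `a` for an ascent, `b` otherwise. -/
def stepWeight (a b : R) (c d : ℤ) : R := if c < d then a else b

/-- The weight of a signed permutation, as a product over its steps and its letters. -/
def wordWeight (a b q : R) {n : ℕ} (p : Equiv.Perm (Fin n) × (Fin n → Bool)) : R :=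
  (∏ i ∈ range n, stepWeight a b (bval p i) (bval p (i + 1))) *
    ∏ i : Fin n, if signedVal p i < 0 then q else 1

theorem pow_ascB_mul_pow_desB_mul_pow_negCount (a b q : R) {n : ℕ}
    (p : Equiv.Perm (Fin n) × (Fin n → Bool)) :
    a ^ ascB p * b ^ desB p * q ^ negCount p = wordWeight a b q p := by
  unfold wordWeight stepWeight
  rw [prod_ite, prod_ite]
  simp only [prod_const, one_pow, mul_one, ascB, desB, negCount]
  congr 4
  ext i
  simp only [mem_filter, mem_range, not_lt]
  refine and_congr_right fun hi => ⟨le_of_lt, fun h => lt_of_le_of_ne h ?_⟩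
  exact (bval_ne_bval_succ p hi).symm

theorem prod_sign_insertMax (q : R) {n : ℕ} (k : Fin (n + 1)) (s : Bool)
    (p : Equiv.Perm (Fin n) × (Fin n → Bool)) :
    (∏ i, if signedVal (insertMax k s p) i < 0 then q else 1) =
      (if s then 1 else q) * ∏ i, if signedVal p i < 0 then q else 1 := by
  rw [Fin.prod_univ_succAbove _ k]
  simp only [signedVal_insertMax_self, signedVal_insertMax_succAbove]
  congr 1
  cases s <;> simp <;> omega

theorem wordWeight_insertMax_last (a b q : R) {n : ℕ} (s : Bool)
    (p : Equiv.Perm (Fin n) × (Fin n → Bool)) :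
    wordWeight a b q (insertMax (Fin.last n) s p) =
      (if s then a else q * b) * wordWeight a b q p := by
  unfold wordWeight
  rw [prod_sign_insertMax, prod_range_succ]
  have h1 := bval_insertMax_self (Fin.last n) s p
  have h2 : ∀ j ≤ n, bval (insertMax (Fin.last n) s p) j = bval p j :=
    fun j hj => bval_insertMax_of_le (Fin.last n) s p (by simpa using hj)
  rw [Fin.val_last] at h1
  rw [h1, h2 n le_rfl, prod_congr rfl (g := fun i => stepWeight a b (bval p i) (bval p (i + 1)))]
  · have := abs_le.1 (abs_bval_le p n)
    cases s
    · rw [stepWeight, if_neg (by simp; omega)]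
      simp; ring
    · rw [stepWeight, if_pos (by simp; omega)]
      simp; ring
  · intro i hi
    rw [mem_range] at hi
    rw [h2 i (by omega), h2 (i + 1) (by omega)]

theorem wordWeight_insertMax_castSucc (a b q : R) {n : ℕ} (k : Fin n) (s : Bool)
    (p : Equiv.Perm (Fin n) × (Fin n → Bool)) :
    wordWeight a b q (insertMax k.castSucc s p) =
      (∏ i ∈ (range n).erase k, stepWeight a b (bval p i) (bval p (i + 1))) *
        ((if s then 1 else q) * (a * b)) * ∏ i : Fin n, if signedVal p i < 0 then q else 1 := by
  unfold wordWeight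
  rw [prod_sign_insertMax]
  have h0 := bval_insertMax_self k.castSucc s p
  have h1 : ∀ j ≤ (k : ℕ), bval (insertMax k.castSucc s p) j = bval p j :=
    fun j hj => bval_insertMax_of_le k.castSucc s p (by simpa using hj)
  have h2 : ∀ j, (k : ℕ) < j → j ≤ n → bval (insertMax k.castSucc s p) (j + 1) = bval p j :=
    fun j hj hn => bval_insertMax_of_lt k.castSucc s p (by simpa using hj) hn
  rw [Fin.val_castSucc] at h0
  have hkn := k.is_lt
  have herase : (range n).erase k = range k ∪ Ico (k + 1) n := by
    ext i; simp; omega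
  have hdisj : Disjoint (range k) (Ico (k + 1 : ℕ) n) := by
    rw [disjoint_left]; intro i; simp; omega
  rw [herase, prod_union hdisj, ← prod_range_mul_prod_Ico _ (by omega : (k : ℕ) + 2 ≤ n + 1),
    prod_range_succ, prod_range_succ, ← prod_Ico_add' _ (k + 1 : ℕ) n 1, h0, h1 k le_rfl,
    h2 (k + 1) (by omega) (by omega)]
  rw [prod_congr rfl (s₁ := range (k : ℕ))
    (g := fun i => stepWeight a b (bval p i) (bval p (i + 1)))]
  · rw [prod_congr rfl (s₁ := Ico _ _)
      (g := fun i => stepWeight a b (bval p i) (bval p (i + 1)))]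
    · have := abs_le.1 (abs_bval_le p k)
      have := abs_le.1 (abs_bval_le p (k + 1))
      cases s
      · rw [stepWeight, stepWeight, if_neg (by simp; omega), if_pos (by simp; omega)]
        simp; ring
      · rw [stepWeight, stepWeight, if_pos (by simp; omega), if_neg (by simp; omega)]
        simp; ring
    · intro i hi
      rw [mem_Ico] at hi
      rw [h2 i (by omega) (by omega), h2 (i + 1) (by omega) (by omega)]
  · intro i hi
    rw [mem_range] at hi
    rw [h1 i (by omega), h1 (i + 1) (by omega)]

theorem sum_wordWeight_insertMax (a b q : R) {n : ℕ} (p : Equiv.Perm (Fin n) × (Fin n → Bool)) :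
    ∑ t : Fin (n + 1) × Bool, wordWeight a b q (insertMax t.1 t.2 p) =
      (a + q * b) * wordWeight a b q p +
        (∑ k ∈ range n, ∏ i ∈ (range n).erase k, stepWeight a b (bval p i) (bval p (i + 1))) *
          ((1 + q) * (a * b)) * ∏ i : Fin n, if signedVal p i < 0 then q else 1 := by
  rw [Fintype.sum_prod_type, Fin.sum_univ_castSucc, add_comm]
  simp only [Fintype.sum_bool, wordWeight_insertMax_last, wordWeight_insertMax_castSucc]
  rw [Finset.sum_range, Finset.sum_mul, Finset.sum_mul]
  congr 1
  · simp; ring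
  · refine Finset.sum_congr rfl fun k _ => ?_
    simp; ring

end weight

section derivation

variable {A R : Type*} [CommRing A] [CommRing R] [Algebra A R] (D : Derivation A R R)

theorem Derivation.prod_of_apply_eq_const {ι : Type*} [DecidableEq ι] (s : Finset ι) (g : ι → R)
    (c : R) (h : ∀ i, D (g i) = c) :
    D (∏ i ∈ s, g i) = (∑ k ∈ s, ∏ i ∈ s.erase k, g i) * c := by
  induction s using Finset.induction_on with
  | empty => simp
  | insert j s hj ih =>
    rw [prod_insert hj, D.leibniz, ih, h, sum_insert hj, erase_insert hj]
    have : ∑ k ∈ s, ∏ i ∈ (insert j s).erase k, g i = g j * ∑ k ∈ s, ∏ i ∈ s.erase k, g i := by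
      rw [mul_sum]
      refine sum_congr rfl fun k hk => ?_
      rw [erase_insert_of_ne (by rintro rfl; exact hj hk),
        prod_insert (fun hm => hj (mem_of_mem_erase hm))]
    rw [this, smul_eq_mul, smul_eq_mul]
    ring

theorem Derivation.apply_wordWeight {a b q : R} (ha : D a = (1 + q) * (a * b))
    (hb : D b = (1 + q) * (a * b)) (hq : D q = 0) {n : ℕ}
    (p : Equiv.Perm (Fin n) × (Fin n → Bool)) :
    D (wordWeight a b q p) =
      (∑ k ∈ range n, ∏ i ∈ (range n).erase k, stepWeight a b (bval p i) (bval p (i + 1))) *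
        ((1 + q) * (a * b)) * ∏ i : Fin n, if signedVal p i < 0 then q else 1 := by
  unfold wordWeight
  rw [D.leibniz, D.prod_of_apply_eq_const _ _ 0,
    D.prod_of_apply_eq_const _ _ ((1 + q) * (a * b))]
  · simp only [mul_zero, smul_eq_mul]
    ring
  · intro i
    unfold stepWeight
    split_ifs <;> assumption
  · intro i
    split_ifs <;> simp [hq]

theorem Derivation.iterate_apply_eq_mul_sum_wordWeight {a b q m : R}
    (ha : D a = (1 + q) * (a * b)) (hb : D b = (1 + q) * (a * b)) (hq : D q = 0)
    (hm : D m = m * (a + q * b)) (n : ℕ) :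
    (⇑D)^[n] m = m * ∑ p : Equiv.Perm (Fin n) × (Fin n → Bool), wordWeight a b q p := by
  induction n with
  | zero => simp [wordWeight]
  | succ n ih =>
    have hsum : ∑ p : Equiv.Perm (Fin (n + 1)) × (Fin (n + 1) → Bool), wordWeight a b q p =
        ∑ p : Equiv.Perm (Fin n) × (Fin n → Bool),
          ((a + q * b) * wordWeight a b q p + D (wordWeight a b q p)) := by
      rw [← insertMax_bijective.sum_comp (wordWeight a b q)]
      refine (Fintype.sum_prod_type_right _).trans (sum_congr rfl fun p _ => ?_)
      rw [sum_wordWeight_insertMax, D.apply_wordWeight ha hb hq]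
    rw [Function.iterate_succ_apply', ih, hsum, D.leibniz, hm, map_sum, sum_add_distrib,
      ← mul_sum, smul_eq_mul, smul_eq_mul]
    ring

end derivation

theorem stmt4
    (D : Derivation ℚ (MvPolynomial (Fin 5) ℚ) (MvPolynomial (Fin 5) ℚ))
    (hx : D (X 0) = X 4 * X 0 * X 1 * X 3) (hy : D (X 1) = X 0 * X 1 * X 2)
    (hz : D (X 2) = X 1 * X 2 * X 3) (hu : D (X 3) = X 4 * X 0 * X 2 * X 3)
    (hq : D (X 4) = 0) :
    ∀ n : ℕ, 1 ≤ n →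
      (⇑D)^[n] (X 0 * X 1) =
        X 0 * X 1 * ∑ p : Equiv.Perm (Fin n) × (Fin n → Bool),
          (X 0 * X 2) ^ ascB p * (X 1 * X 3) ^ desB p * X 4 ^ negCount p := by
  intro n _
  simp only [pow_ascB_mul_pow_desB_mul_pow_negCount]
  refine D.iterate_apply_eq_mul_sum_wordWeight ?_ ?_ hq ?_ n <;>
  · simp only [D.leibniz, hx, hy, hz, hu, smul_eq_mul]
    ring
end

section
/- Let D be the ℚ-linear derivation on the polynomial ring ℚ[x,y,z,e] determined by D(x) = x·y, D(y) = x·y, D(z) = x·y and D(e) = e·z. Then for every n ≥ 1, D^n(e) = e · Σ_{π ∈ S_n} x^{exc(π)} y^{dc(π)} z^{fix(π)}, where the sum is over all permutations π of [n]. -/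
open MvPolynomial Finset

/-- `dc π = #{i : π(i) < i}`. -/
def dc {n : ℕ} (π : Equiv.Perm (Fin n)) : ℕ :=
  (Finset.univ.filter fun i => π i < i).card

/-- `fix π = #{i : π(i) = i}`. -/
def fixCount {n : ℕ} (π : Equiv.Perm (Fin n)) : ℕ :=
  (Finset.univ.filter fun i => π i = i).card

theorem Derivation.leibniz_finset_prod {R A ι : Type*} [CommRing R] [CommRing A] [Algebra R A]
    [DecidableEq ι] (D : Derivation R A A) (s : Finset ι) (f : ι → A) :
    D (∏ i ∈ s, f i) = ∑ i ∈ s, D (f i) * ∏ j ∈ s.erase i, f j := by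
  induction s using Finset.induction_on with
  | empty => simp
  | insert a s ha ih =>
    rw [prod_insert ha, D.leibniz, ih, sum_insert ha, erase_insert ha, smul_eq_mul, smul_eq_mul,
      mul_sum, add_comm]
    congr 1
    · exact mul_comm _ _
    · refine sum_congr rfl fun i hi => ?_
      have hai : a ≠ i := fun h => ha (h ▸ hi)
      rw [erase_insert_of_ne hai, prod_insert fun h => ha (mem_of_mem_erase h)]
      ring

section PermWeight

variable {A : Type*}

/-- The factor contributed by an arc `i ↦ j` of a permutation. -/
def arcWeight (x y z : A) {n : ℕ} (i j : Fin n) : A :=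
  if i < j then x else if j < i then y else z

theorem arcWeight_succ (x y z : A) {n : ℕ} (i j : Fin n) :
    arcWeight x y z i.succ j.succ = arcWeight x y z i j := by
  simp [arcWeight]

variable [CommRing A]

theorem prod_arcWeight (x y z : A) {n : ℕ} (π : Equiv.Perm (Fin n)) :
    ∏ i, arcWeight x y z i (π i) = x ^ exc π * y ^ dc π * z ^ fixCount π := by
  simp only [exc, dc, fixCount, ← prod_const, prod_filter, ← prod_mul_distrib]
  refine prod_congr rfl fun i _ => ?_
  rcases lt_trichotomy i (π i) with h | h | h
  · simp [arcWeight, h, h.not_gt, h.ne']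
  · simp [arcWeight, ← h]
  · simp [arcWeight, h, h.not_gt, h.ne]

theorem prod_arcWeight_decomposeFin_zero (x y z : A) {n : ℕ} (e : Equiv.Perm (Fin n)) :
    ∏ i, arcWeight x y z i (Equiv.Perm.decomposeFin.symm (0, e) i) =
      z * ∏ i, arcWeight x y z i (e i) := by
  rw [Fin.prod_univ_succ]
  simp only [Equiv.Perm.decomposeFin_symm_apply_zero, Equiv.Perm.decomposeFin_symm_apply_succ,
    Equiv.swap_self, Equiv.refl_apply, arcWeight_succ]
  simp [arcWeight]

theorem prod_arcWeight_decomposeFin_succ (x y z : A) {n : ℕ} (e : Equiv.Perm (Fin n))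
    (k : Fin n) :
    ∏ i, arcWeight x y z i (Equiv.Perm.decomposeFin.symm ((e k).succ, e) i) =
      x * y * ∏ i ∈ univ.erase k, arcWeight x y z i (e i) := by
  rw [Fin.prod_univ_succ, ← mul_prod_erase univ _ (mem_univ k), mul_assoc]
  simp only [Equiv.Perm.decomposeFin_symm_apply_zero, Equiv.Perm.decomposeFin_symm_apply_succ,
    Equiv.swap_apply_right]
  refine congrArg₂ _ (by simp [arcWeight]) (congrArg₂ _ (by simp [arcWeight]) ?_)
  refine prod_congr rfl fun i hi => ?_
  have hik : e i ≠ e k := e.injective.ne (ne_of_mem_erase hi)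
  rw [Equiv.swap_apply_of_ne_of_ne (Fin.succ_ne_zero _) ((Fin.succ_injective _).ne hik),
    arcWeight_succ]

theorem sum_prod_arcWeight_succ {R : Type*} [CommRing R] [Algebra R A] (D : Derivation R A A)
    {x y z : A} (hx : D x = x * y) (hy : D y = x * y) (hz : D z = x * y) (n : ℕ) :
    ∑ π : Equiv.Perm (Fin (n + 1)), ∏ i, arcWeight x y z i (π i) =
      z * ∑ π : Equiv.Perm (Fin n), ∏ i, arcWeight x y z i (π i) +
        D (∑ π : Equiv.Perm (Fin n), ∏ i, arcWeight x y z i (π i)) := by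
  have hD (i j : Fin n) : D (arcWeight x y z i j) = x * y := by
    unfold arcWeight
    split_ifs <;> assumption
  rw [map_sum, mul_sum, ← sum_add_distrib, ← Equiv.Perm.decomposeFin.symm.sum_comp,
    Fintype.sum_prod_type_right]
  refine sum_congr rfl fun e _ => ?_
  rw [Fin.sum_univ_succ, prod_arcWeight_decomposeFin_zero, D.leibniz_finset_prod, ← Equiv.sum_comp e]
  simp only [prod_arcWeight_decomposeFin_succ, hD]

end PermWeight

theorem stmt14
    (D : Derivation ℚ (MvPolynomial (Fin 4) ℚ) (MvPolynomial (Fin 4) ℚ))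
    (hx : D (X 0) = X 0 * X 1) (hy : D (X 1) = X 0 * X 1)
    (hz : D (X 2) = X 0 * X 1) (he : D (X 3) = X 3 * X 2) :
    ∀ n : ℕ, 1 ≤ n →
      (⇑D)^[n] (X 3) =
        X 3 * ∑ π : Equiv.Perm (Fin n),
          X 0 ^ exc π * X 1 ^ dc π * X 2 ^ fixCount π := by
  rintro n -
  simp only [← prod_arcWeight]
  induction n with
  | zero => simp
  | succ n ih =>
    rw [Function.iterate_succ_apply', ih, D.leibniz, he, sum_prod_arcWeight_succ D hx hy hz,
      smul_eq_mul, smul_eq_mul]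
    ring
end

section
/- Let d(n,i,j) be the number of type B derangements of [n] with exactly i weak excedances and exactly j anti-excedances. Then for all n ≥ 1 and all integers i, j ≥ 0: d(n+1,i,j) = d(n,i,j) + 2i·d(n,i,j−1) + 2j·d(n,i−1,j) + 4(n−i−j+2)·d(n,i−1,j−1), where d(n,i,j) = 0 whenever i < 0 or j < 0. -/
open Finset

/-- `wexc π = #{i ∈ [n] : π(|π(i)|) > π(i)}`, the number of weak excedances. -/
def wexcB {n : ℕ} (p : Equiv.Perm (Fin n) × (Fin n → Bool)) : ℕ :=
  (Finset.univ.filter fun i : Fin n => signedVal p i < signedVal p (p.1 i)).card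

/-- `aexc π = #{i ∈ [n] : π(|π(i)|) < π(i)}`, the number of anti-excedances. -/
def aexcB {n : ℕ} (p : Equiv.Perm (Fin n) × (Fin n → Bool)) : ℕ :=
  (Finset.univ.filter fun i : Fin n => signedVal p (p.1 i) < signedVal p i).card

/-- `d(n,i,j)`: the number of type B derangements of `[n]` with exactly `i` weak
excedances and exactly `j` anti-excedances (in particular `0` if `i < 0` or `j < 0`). -/
def dB (n : ℕ) (i j : ℤ) : ℕ :=
  (Finset.univ.filter fun p : Equiv.Perm (Fin n) × (Fin n → Bool) =>
    (∀ t : Fin n, signedVal p t ≠ (t : ℕ) + 1) ∧ (wexcB p : ℤ) = i ∧ (aexcB p : ℤ) = j).card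

section CyclicWords

variable {α : Type*}

/-- The letter `m`, of absolute value `a m`, with the sign given by `s`. -/
def letter (a : α → ℤ) (s : α → Bool) (m : α) : ℤ := (if s m then 1 else -1) * a m

lemma letter_injective {a : α → ℤ} (ha : Function.Injective a) (hpos : ∀ m, 0 < a m)
    (s : α → Bool) : Function.Injective (letter a s) := by
  intro x y h
  have hx := hpos x
  have hy := hpos y
  apply ha
  unfold letter at h
  split_ifs at h <;> linarith

variable [Fintype α] [DecidableEq α]

/-- The number of cyclic ascents in the cycles of `σ`, read as words in signed letters. -/
def cycAsc (a : α → ℤ) (σ : Equiv.Perm α) (s : α → Bool) : ℤ :=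
  ∑ m, if letter a s m < letter a s (σ m) then 1 else 0

/-- The number of cyclic descents in the cycles of `σ`, read as words in signed letters. -/
def cycDes (a : α → ℤ) (σ : Equiv.Perm α) (s : α → Bool) : ℤ :=
  ∑ m, if letter a s (σ m) < letter a s m then 1 else 0

/-- The indicator that `σ` has no positive singleton cycle, `i` cyclic ascents and `j` cyclic
descents. -/
def cycInd (a : α → ℤ) (i j : ℤ) (σ : Equiv.Perm α) (s : α → Bool) : ℤ :=
  if (∀ m, σ m = m → s m = false) ∧ cycAsc a σ s = i ∧ cycDes a σ s = j then 1 else 0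

/-- The variant of `cycInd` which allows `m` to be a positive singleton cycle. -/
def cycIndOff (a : α → ℤ) (i j : ℤ) (m : α) (σ : Equiv.Perm α) (s : α → Bool) : ℤ :=
  if (∀ x, x ≠ m → σ x = x → s x = false) ∧ cycAsc a σ s = i ∧ cycDes a σ s = j then 1 else 0

lemma cycAsc_add_cycDes_add_card_fixed (a : α → ℤ) (ha : Function.Injective a) (hpos : ∀ m, 0 < a m)
    (σ : Equiv.Perm α) (s : α → Bool) :
    cycAsc a σ s + cycDes a σ s + (∑ m, if σ m = m then 1 else 0) = Fintype.card α := by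
  have h : ∀ m, (if letter a s m < letter a s (σ m) then (1 : ℤ) else 0) +
      (if letter a s (σ m) < letter a s m then 1 else 0) + (if σ m = m then 1 else 0) = 1 := by
    intro m
    by_cases hm : σ m = m
    · simp [hm]
    · have := (letter_injective ha hpos s).ne hm
      rcases lt_or_gt_of_ne this with h | h <;> simp [hm, h, h.not_gt]
  simp only [cycAsc, cycDes, ← sum_add_distrib, h]
  simp

/-- Flipping the sign of a singleton cycle. -/
lemma sum_cycIndOff (a : α → ℤ) (i j : ℤ) (σ : Equiv.Perm α) (m : α) (hm : σ m = m) :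
    ∑ s, cycIndOff a i j m σ s = 2 * ∑ s, cycInd a i j σ s := by
  let flip : (α → Bool) → (α → Bool) := fun s => Function.update s m (!s m)
  have hflip : Function.Involutive flip := by
    intro s
    ext x
    by_cases hx : x = m
    · subst hx; simp [flip]
    · simp [flip]
  have hne : ∀ s x, x ≠ m → letter a (flip s) x = letter a s x := by
    intro s x hx
    simp [letter, flip, hx]
  have hσ : ∀ x, x ≠ m → σ x ≠ m := fun x hx h => hx (σ.injective (h.trans hm.symm))
  have hasc : ∀ s, cycAsc a σ (flip s) = cycAsc a σ s := by
    intro s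
    refine sum_congr rfl fun x _ => ?_
    by_cases hx : x = m
    · simp [hx, hm]
    · rw [hne s x hx, hne s _ (hσ x hx)]
  have hdes : ∀ s, cycDes a σ (flip s) = cycDes a σ s := by
    intro s
    refine sum_congr rfl fun x _ => ?_
    by_cases hx : x = m
    · simp [hx, hm]
    · rw [hne s x hx, hne s _ (hσ x hx)]
  have key : ∀ s, cycIndOff a i j m σ s = cycInd a i j σ s + cycInd a i j σ (flip s) := by
    intro s
    have h₁ : (∀ x, σ x = x → s x = false) ↔
        (∀ x, x ≠ m → σ x = x → s x = false) ∧ s m = false := by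
      refine ⟨fun h => ⟨fun x _ => h x, h m hm⟩, fun h x hx => ?_⟩
      by_cases hxm : x = m
      · rw [hxm]; exact h.2
      · exact h.1 x hxm hx
    have h₂ : (∀ x, σ x = x → flip s x = false) ↔
        (∀ x, x ≠ m → σ x = x → s x = false) ∧ s m = true := by
      refine ⟨fun h => ⟨fun x hxm hx => ?_, ?_⟩, fun h x hx => ?_⟩
      · simpa [flip, hxm] using h x hx
      · simpa [flip] using h m hm
      · by_cases hxm : x = m
        · simp [flip, hxm, h.2]
        · simpa [flip, hxm] using h.1 x hxm hx
    simp only [cycInd, cycIndOff, hasc, hdes, h₁, h₂]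
    cases s m <;> simp
  simp only [key, sum_add_distrib]
  have hsum := Equiv.sum_comp hflip.toPerm (fun s => cycInd a i j σ s)
  simp only [Function.Involutive.coe_toPerm] at hsum
  rw [hsum, two_mul]

/-- Inserting a letter of largest absolute value right after the letter `m`. -/
lemma cycInd_insert (a : α → ℤ) (N : ℤ) (hpos : ∀ m, 0 < a m) (hN : ∀ m, a m < N)
    (i j : ℤ) (σ : Equiv.Perm α) (s : α → Bool) (m : α) (b : Bool) :
    cycInd (fun x : Option α => x.elim N a) i j
        (Equiv.swap none (some (σ m)) * Equiv.optionCongr σ) (fun x => x.elim b s) =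
      if (∀ x, x ≠ m → σ x = x → s x = false) ∧
        cycAsc a σ s + 1 - (if letter a s m < letter a s (σ m) then 1 else 0) = i ∧
        cycDes a σ s + 1 - (if letter a s (σ m) < letter a s m then 1 else 0) = j
      then 1 else 0 := by
  set τ := Equiv.swap none (some (σ m)) * Equiv.optionCongr σ with hτ
  have hnone : τ none = some (σ m) := by simp [hτ]
  have hm : τ (some m) = none := by simp [hτ]
  have hsome : ∀ x, x ≠ m → τ (some x) = some (σ x) := by
    intro x hx
    simp only [hτ, Equiv.Perm.mul_apply, Equiv.optionCongr_apply, Option.map_some]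
    exact Equiv.swap_apply_of_ne_of_ne (by simp) (by simpa using hx)
  set a' : Option α → ℤ := fun x => x.elim N a
  set s' : Option α → Bool := fun x => x.elim b s
  have hl : ∀ x, letter a' s' (some x) = letter a s x := fun x => rfl
  have hlN : letter a' s' none = (if b then 1 else -1) * N := rfl
  have hlt : ∀ x, letter a s x < N ∧ -N < letter a s x := by
    intro x
    have h₁ := hpos x
    have h₂ := hN x
    unfold letter
    split_ifs <;> constructor <;> linarith
  have hgood : (∀ x, τ x = x → s' x = false) ↔ ∀ x, x ≠ m → σ x = x → s x = false := by
    constructor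
    · intro h x hxm hx
      exact h (some x) (by rw [hsome x hxm, hx])
    · rintro h (_ | x) hx
      · rw [hnone] at hx; cases hx
      · by_cases hxm : x = m
        · rw [hxm, hm] at hx; cases hx
        · rw [hsome x hxm] at hx
          exact h x hxm (Option.some.inj hx)
  have hasc : cycAsc a' τ s' =
      cycAsc a σ s + 1 - (if letter a s m < letter a s (σ m) then 1 else 0) := by
    unfold cycAsc
    rw [Fintype.sum_option, ← add_sum_erase univ _ (mem_univ m), ← add_sum_erase univ
      (fun m => if letter a s m < letter a s (σ m) then (1 : ℤ) else 0) (mem_univ m), hnone, hm]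
    have : ∀ x ∈ univ.erase m,
        (if letter a' s' (some x) < letter a' s' (τ (some x)) then (1 : ℤ) else 0) =
          if letter a s x < letter a s (σ x) then 1 else 0 := by
      intro x hx
      rw [hsome x (ne_of_mem_erase hx), hl, hl]
    rw [sum_congr rfl this, hl, hl, hlN]
    have h₁ := hlt m
    have h₂ := hlt (σ m)
    cases b
    · simp [h₂.2, h₁.2.not_gt, -sum_boole]
      ring
    · simp [h₁.1, h₂.1.not_gt, -sum_boole]
      ring
  have hdes : cycDes a' τ s' =
      cycDes a σ s + 1 - (if letter a s (σ m) < letter a s m then 1 else 0) := by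
    unfold cycDes
    rw [Fintype.sum_option, ← add_sum_erase univ _ (mem_univ m), ← add_sum_erase univ
      (fun m => if letter a s (σ m) < letter a s m then (1 : ℤ) else 0) (mem_univ m), hnone, hm]
    have : ∀ x ∈ univ.erase m,
        (if letter a' s' (τ (some x)) < letter a' s' (some x) then (1 : ℤ) else 0) =
          if letter a s (σ x) < letter a s x then 1 else 0 := by
      intro x hx
      rw [hsome x (ne_of_mem_erase hx), hl, hl]
    rw [sum_congr rfl this, hl, hl, hlN]
    have h₁ := hlt m
    have h₂ := hlt (σ m)
    cases b
    · simp [h₁.2, h₂.2.not_gt, -sum_boole]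
      ring
    · simp [h₂.1, h₁.1.not_gt, -sum_boole]
      ring
  simp only [cycInd, hgood, hasc, hdes]

lemma cycInd_insert_eq_add (a : α → ℤ) (ha : Function.Injective a) (N : ℤ)
    (hpos : ∀ m, 0 < a m) (hN : ∀ m, a m < N)
    (i j : ℤ) (σ : Equiv.Perm α) (s : α → Bool) (m : α) (b : Bool) :
    cycInd (fun x : Option α => x.elim N a) i j
        (Equiv.swap none (some (σ m)) * Equiv.optionCongr σ) (fun x => x.elim b s) =
      (if letter a s m < letter a s (σ m) then 1 else 0) * cycInd a i (j - 1) σ s +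
      (if letter a s (σ m) < letter a s m then 1 else 0) * cycInd a (i - 1) j σ s +
      (if σ m = m then 1 else 0) * cycIndOff a (i - 1) (j - 1) m σ s := by
  rw [cycInd_insert a N hpos hN]
  by_cases hm : σ m = m
  · simp [hm, cycIndOff, eq_sub_iff_add_eq]
  · have hgood : (∀ x, x ≠ m → σ x = x → s x = false) ↔ ∀ x, σ x = x → s x = false :=
      ⟨fun h x hx => h x (by rintro rfl; exact hm hx) hx, fun h x _ => h x⟩
    have := (letter_injective ha hpos s).ne hm
    rcases lt_or_gt_of_ne this with h | h <;>
      simp [hm, h, h.not_gt, hgood, cycInd, eq_sub_iff_add_eq]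

/-- Adding a letter as a singleton cycle. -/
lemma cycInd_singleton (a : α → ℤ) (N i j : ℤ) (σ : Equiv.Perm α) (s : α → Bool) (b : Bool) :
    cycInd (fun x : Option α => x.elim N a) i j
        (Equiv.swap none none * Equiv.optionCongr σ) (fun x => x.elim b s) =
      if b then 0 else cycInd a i j σ s := by
  have hl : ∀ x, letter (fun x : Option α => x.elim N a) (fun x => x.elim b s) (some x) =
    letter a s x := fun x => rfl
  cases b
  · simp [cycInd, cycAsc, cycDes, Fintype.sum_option, hl, Option.forall, -sum_boole]
    congr
  · simp [cycInd, Option.forall]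

lemma cycAsc_mul_cycInd_and_cycDes_mul_cycInd (a : α → ℤ) (i j : ℤ) (σ : Equiv.Perm α) (s : α → Bool) :
    cycAsc a σ s * cycInd a i j σ s = i * cycInd a i j σ s ∧
      cycDes a σ s * cycInd a i j σ s = j * cycInd a i j σ s := by
  unfold cycInd
  split_ifs with h
  · simp [h.2.1, h.2.2]
  · simp

lemma sum_cycInd_option (a : α → ℤ) (ha : Function.Injective a) (N : ℤ)
    (hpos : ∀ m, 0 < a m) (hN : ∀ m, a m < N) (i j : ℤ) :
    ∑ σ, ∑ s, cycInd (fun x : Option α => x.elim N a) i j σ s =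
      (∑ σ, ∑ s, cycInd a i j σ s) + 2 * i * (∑ σ, ∑ s, cycInd a i (j - 1) σ s) +
        2 * j * (∑ σ, ∑ s, cycInd a (i - 1) j σ s) +
        4 * (Fintype.card α - i - j + 2) * (∑ σ, ∑ s, cycInd a (i - 1) (j - 1) σ s) := by
  have hsign : ∀ f : (Option α → Bool) → ℤ,
      ∑ s, f s = ∑ s : α → Bool, ∑ b : Bool, f (fun x => x.elim b s) := by
    intro f
    rw [← Equiv.sum_comp (Equiv.piOptionEquivProd (β := fun _ : Option α => Bool)).symm f,
      Fintype.sum_prod_type_right]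
    refine sum_congr rfl fun s _ => sum_congr rfl fun b _ => congrArg f ?_
    ext (_ | x) <;> rfl
  rw [← Equiv.sum_comp Equiv.Perm.decomposeOption.symm, Fintype.sum_prod_type_right]
  simp only [mul_sum, ← sum_add_distrib]
  refine sum_congr rfl fun σ _ => ?_
  simp only [Equiv.Perm.decomposeOption_symm_apply, hsign]
  rw [Fintype.sum_option, ← Equiv.sum_comp σ]
  simp only [cycInd_singleton, cycInd_insert_eq_add a ha N hpos hN, Fintype.sum_bool]
  have hfix : ∑ m, ∑ s, (if σ m = m then 1 else 0) * cycIndOff a (i - 1) (j - 1) m σ s =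
      ∑ s, (∑ m, if σ m = m then 1 else 0) * (2 * cycInd a (i - 1) (j - 1) σ s) := by
    rw [← mul_sum, sum_mul]
    refine sum_congr rfl fun m _ => ?_
    rw [← mul_sum, ← mul_sum]
    split_ifs with hm
    · rw [sum_cycIndOff a _ _ σ m hm]
    · simp
  have hmain : ∑ m, ∑ s, ((if letter a s m < letter a s (σ m) then 1 else 0) *
        cycInd a i (j - 1) σ s +
      (if letter a s (σ m) < letter a s m then 1 else 0) * cycInd a (i - 1) j σ s +
      (if σ m = m then 1 else 0) * cycIndOff a (i - 1) (j - 1) m σ s) =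
      ∑ s, (i * cycInd a i (j - 1) σ s + j * cycInd a (i - 1) j σ s +
        (Fintype.card α - i - j + 2) * (2 * cycInd a (i - 1) (j - 1) σ s)) := by
    simp only [sum_add_distrib]
    rw [hfix, sum_comm, sum_comm (f := fun m s =>
      (if letter a s (σ m) < letter a s m then 1 else 0) * cycInd a (i - 1) j σ s)]
    simp only [← sum_add_distrib, ← sum_mul]
    refine sum_congr rfl fun s _ => ?_
    have h₁ := (cycAsc_mul_cycInd_and_cycDes_mul_cycInd a i (j - 1) σ s).1
    have h₂ := (cycAsc_mul_cycInd_and_cycDes_mul_cycInd a (i - 1) j σ s).2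
    have h₃ := cycAsc_mul_cycInd_and_cycDes_mul_cycInd a (i - 1) (j - 1) σ s
    have h₄ := cycAsc_add_cycDes_add_card_fixed a ha hpos σ s
    change cycAsc a σ s * _ + cycDes a σ s * _ + _ = _
    linear_combination h₁ + h₂ - 2 * h₃.1 - 2 * h₃.2 +
      2 * cycInd a (i - 1) (j - 1) σ s * h₄
  have htwo : ∀ f : α → (α → Bool) → ℤ, ∑ m, ∑ s, (f m s + f m s) = 2 * ∑ m, ∑ s, f m s := by
    intro f
    simp only [sum_add_distrib, two_mul]
  rw [htwo, hmain, mul_sum, ← sum_add_distrib]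
  refine sum_congr rfl fun s _ => ?_
  simp
  ring

lemma dB_eq_sum_cycInd {n : ℕ} (e : α ≃ Fin n) (i j : ℤ) :
    (dB n i j : ℤ) = ∑ σ, ∑ s, cycInd (fun m => ((e m : ℕ) : ℤ) + 1) i j σ s := by
  set a : α → ℤ := fun m => ((e m : ℕ) : ℤ) + 1 with ha
  rw [dB, card_filter, Nat.cast_sum, Fintype.sum_prod_type, ← Equiv.sum_comp e.permCongr]
  refine sum_congr rfl fun σ _ => ?_
  rw [← Equiv.sum_comp ((σ.symm.trans e).arrowCongr (Equiv.refl Bool))]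
  refine sum_congr rfl fun s _ => ?_
  set p : Equiv.Perm (Fin n) × (Fin n → Bool) :=
    (e.permCongr σ, (σ.symm.trans e).arrowCongr (Equiv.refl Bool) s) with hp
  have hval : ∀ m, signedVal p (e m) = letter a s (σ m) := by
    intro m
    simp [signedVal, letter, hp, ha]
  have hperm : ∀ m, p.1 (e m) = e (σ m) := by
    intro m
    simp [hp]
  have hgood : (∀ t, signedVal p t ≠ (t : ℕ) + 1) ↔ ∀ m, σ m = m → s m = false := by
    rw [e.symm.forall_congr_left]
    refine forall_congr' fun m => ?_
    rw [Equiv.symm_symm, hval]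
    have h : ∀ x y : Fin n, ((x : ℕ) : ℤ) = ((y : ℕ) : ℤ) ↔ x = y := by
      intro x y
      rw [Nat.cast_inj, Fin.val_inj]
    by_cases hm : σ m = m
    · cases hs : s m
      · simp [letter, ha, hm, hs]
        omega
      · simp [letter, ha, hm, hs]
    · cases hs : s (σ m)
      · simp [letter, ha, hm, hs]
        omega
      · simp [letter, ha, hm, hs, h]
  have hasc : (wexcB p : ℤ) = cycAsc a σ s := by
    rw [wexcB, card_filter, Nat.cast_sum, cycAsc, ← Equiv.sum_comp e, ← Equiv.sum_comp σ
      (fun m => if letter a s m < letter a s (σ m) then (1 : ℤ) else 0)]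
    simp only [hperm, hval, Nat.cast_ite, Nat.cast_one, Nat.cast_zero]
  have hdes : (aexcB p : ℤ) = cycDes a σ s := by
    rw [aexcB, card_filter, Nat.cast_sum, cycDes, ← Equiv.sum_comp e, ← Equiv.sum_comp σ
      (fun m => if letter a s (σ m) < letter a s m then (1 : ℤ) else 0)]
    simp only [hperm, hval, Nat.cast_ite, Nat.cast_one, Nat.cast_zero]
  simp only [cycInd, hgood, hasc, hdes, Nat.cast_ite, Nat.cast_one, Nat.cast_zero]

end CyclicWords

theorem stmt17 :
    ∀ n : ℕ, 1 ≤ n → ∀ i j : ℤ, 0 ≤ i → 0 ≤ j →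
      (dB (n + 1) i j : ℤ) =
        dB n i j + 2 * i * dB n i (j - 1) + 2 * j * dB n (i - 1) j +
          4 * ((n : ℤ) - i - j + 2) * dB n (i - 1) (j - 1) := by
  intro n _ i j _ _
  have hsucc := dB_eq_sum_cycInd (finSuccEquivLast (n := n)).symm i j
  have ha : (fun m => (((finSuccEquivLast (n := n)).symm m : ℕ) : ℤ) + 1) =
      fun x : Option (Fin n) => x.elim ((n : ℤ) + 1) (fun m => ((m : ℕ) : ℤ) + 1) := by
    ext (_ | x) <;> simp
  rw [hsucc, ha, sum_cycInd_option _ _ _ (fun m => by positivity) (fun m => by simp) i j,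
    Fintype.card_fin]
  · simp only [dB_eq_sum_cycInd (Equiv.refl (Fin n)), Equiv.refl_apply]
  · intro x y h
    simpa [Fin.ext_iff] using h
end
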